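/- arXiv:1105.4083 — 2 statements merged into one kernel-verified Lean document; each statement's English description precedes it below -/
import Mathlib

section
/- Let P, Q ∈ F_{q^r}[X,σ] be monic nonconstant skew polynomials. Define Ψ(P) ∈ F_q[Y] to be the characteristic polynomial of the F_{q^r}-linear map φ^r on the φ-module D_P associated to P. Then Ψ(PQ) = Ψ(P)·Ψ(Q). -/
/-- Multiplication in the skew polynomial ring `F[X,σ]` with `σ x = x ^ q`, so that
`X * a = a ^ q * X`. -/
noncomputable def skewMul {K : Type*} [Field K] (q : ℕ) (P Q : Polynomial K) : Polynomial K :=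
  ∑ i ∈ P.support, ∑ j ∈ Q.support,
    Polynomial.C (P.coeff i * Q.coeff j ^ q ^ i) * Polynomial.X ^ (i + j)

/-- The companion matrix `Γ_P` of a monic skew polynomial `P` of degree `d`:
`φ(eⱼ) = eⱼ₊₁` for `j < d−1` and `φ(e_{d-1}) = Σ (−P.coeff i) eᵢ`. -/
noncomputable def skewCompanion {K : Type*} [Field K] (P : Polynomial K) :
    Matrix (Fin P.natDegree) (Fin P.natDegree) K :=
  Matrix.of fun i j =>
    if (j : ℕ) = P.natDegree - 1 then -P.coeff i
    else if (i : ℕ) = (j : ℕ) + 1 then 1 else 0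

/-- `Ψ(P) ∈ F_q[Y]`: the characteristic polynomial of `φ^r` on `D_P`, i.e. of the matrix
`Γ_P ⬝ σ(Γ_P) ⬝ ⋯ ⬝ σ^{r-1}(Γ_P)` where `σ x = x^q` is applied entrywise. -/
noncomputable def Psi {K : Type*} [Field K] (q r : ℕ) (P : Polynomial K) : Polynomial K :=
  Matrix.charpoly (((List.range r).map
    (fun i => (skewCompanion P).map (fun x => x ^ q ^ i))).prod)

/-- Companion matrix with free size. -/
noncomputable def compG {K : Type*} [Field K] (d : ℕ) (P : Polynomial K) :
    Matrix (Fin d) (Fin d) K :=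
  Matrix.of fun i j =>
    if (j : ℕ) = d - 1 then -P.coeff i
    else if (i : ℕ) = (j : ℕ) + 1 then 1 else 0

theorem Psi_eq_compG {K : Type*} [Field K] (q r d : ℕ) (P : Polynomial K)
    (h : P.natDegree = d) :
    Psi q r P = Matrix.charpoly (((List.range r).map
      (fun i => (compG d P).map (fun x => x ^ q ^ i))).prod) := by
  subst h; rfl

/-- The action of the companion matrix on coordinates. -/
theorem compG_row {K : Type*} [Field K] (d : ℕ) (R f : Polynomial K) (i : Fin d) :
    ∑ j : Fin d, compG d R i j * f.coeff j
      = (Polynomial.X * f).coeff i - R.coeff i * f.coeff (d - 1) := by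
  obtain ⟨i, hi⟩ := i
  obtain ⟨e, rfl⟩ : ∃ e, d = e + 1 := ⟨d - 1, by omega⟩
  rw [Fin.sum_univ_castSucc]
  have h1 : ∀ j : Fin e, compG (e+1) R ⟨i, hi⟩ j.castSucc * f.coeff (j.castSucc : Fin (e+1))
      = if i = (j : ℕ) + 1 then f.coeff j else 0 := by
    intro j
    have := j.2
    simp only [compG, Matrix.of_apply, Fin.val_castSucc]
    rw [if_neg (by omega)]
    split_ifs <;> simp
  rw [Finset.sum_congr rfl (fun j _ => h1 j)]
  have h2 : ∑ j : Fin e, (if i = (j : ℕ) + 1 then f.coeff j else 0)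
      = (Polynomial.X * f).coeff i := by
    rw [Fin.sum_univ_eq_sum_range (fun j => if i = j + 1 then f.coeff j else 0) e]
    rcases i with _ | i
    · simp
    · simp only [Nat.add_right_cancel_iff, Finset.sum_ite_eq, Finset.mem_range,
        Polynomial.coeff_X_mul]
      rw [if_pos (by omega)]
  rw [h2]
  simp [compG]
  ring

/-- The columns of the companion matrix. -/
theorem compG_col {K : Type*} [Field K] (P : Polynomial K) (hP : P.Monic) (m : ℕ)
    (hm : P.natDegree = m) (W : ℕ → Polynomial K) (j : Fin m) :
    ∑ k : Fin m, Polynomial.C (compG m P k j) * W k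
      = W (j + 1) - if (j : ℕ) = m - 1 then
          ∑ k ∈ Finset.range (m + 1), Polynomial.C (P.coeff k) * W k else 0 := by
  obtain ⟨j, hj⟩ := j
  have hc : P.coeff m = 1 := by rw [← hm]; exact hP
  simp only [compG, Matrix.of_apply]
  split_ifs with h
  · rw [Finset.sum_range_succ, hc,
      Fin.sum_univ_eq_sum_range (fun k => Polynomial.C (-P.coeff k) * W k) m]
    have : j + 1 = m := by omega
    rw [this]
    simp
  · rw [Fin.sum_univ_eq_sum_range
      (fun k => Polynomial.C (if k = j + 1 then (1 : K) else 0) * W k) m]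
    rw [Finset.sum_eq_single (j + 1)]
    · simp
    · intro b _ hb
      simp [hb]
    · intro hb
      exact absurd (Finset.mem_range.2 (by omega)) hb

/-- Iterating an intertwining relation. -/
theorem prod_intertwine {K ι κ : Type*} [Field K] [Fintype ι] [Fintype κ]
    [DecidableEq ι] [DecidableEq κ]
    (q : ℕ) (τ : ℕ → K →+* K) (hτ : ∀ i x, τ i x = x ^ q ^ i)
    (A : Matrix ι ι K) (B : Matrix κ κ K) (U : Matrix ι κ K)
    (h : A * U.map (fun x => x ^ q) = U * B) (r : ℕ) :
    ((List.range r).map (fun i => A.map (fun x => x ^ q ^ i))).prod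
        * U.map (fun x => x ^ q ^ r)
      = U * ((List.range r).map (fun i => B.map (fun x => x ^ q ^ i))).prod := by
  induction r with
  | zero => ext i j; simp
  | succ r ih =>
    have h2 : A.map (fun x => x ^ q ^ r) * U.map (fun x => x ^ q ^ (r + 1))
        = U.map (fun x => x ^ q ^ r) * B.map (fun x => x ^ q ^ r) := by
      have := congrArg (fun M => M.map (τ r)) h
      simp only [Matrix.map_mul, Matrix.map_map] at this
      have e1 : (τ r : K → K) = fun x => x ^ q ^ r := funext (hτ r)
      have e2 : (τ r : K → K) ∘ (fun x => x ^ q) = fun x => x ^ q ^ (r + 1) := by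
        funext x
        simp only [Function.comp, hτ, ← pow_mul, pow_succ]
        rw [mul_comm]
      rw [e2, e1] at this
      exact this
    simp only [List.range_succ, List.map_append, List.map_cons, List.map_nil, List.prod_append,
      List.prod_cons, List.prod_nil, mul_one]
    rw [Matrix.mul_assoc, h2, ← Matrix.mul_assoc, ih, Matrix.mul_assoc]

theorem prod_blocks {K ι κ : Type*} [Field K] [Fintype ι] [Fintype κ]
    [DecidableEq ι] [DecidableEq κ] (q : ℕ) (hq : q ≠ 0)
    (A : Matrix ι ι K) (B : Matrix κ κ K) (C : Matrix κ ι K) (r : ℕ) :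
    ∃ D, ((List.range r).map
        (fun i => (Matrix.fromBlocks A 0 C B).map (fun x => x ^ q ^ i))).prod
      = Matrix.fromBlocks ((List.range r).map (fun i => A.map (fun x => x ^ q ^ i))).prod 0 D
          ((List.range r).map (fun i => B.map (fun x => x ^ q ^ i))).prod := by
  induction r with
  | zero => exact ⟨0, by simp⟩
  | succ r ih =>
    obtain ⟨D, hD⟩ := ih
    simp only [List.range_succ, List.map_append, List.map_cons, List.map_nil, List.prod_append,
      List.prod_cons, List.prod_nil, mul_one]
    rw [hD, Matrix.fromBlocks_map, Matrix.fromBlocks_multiply]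
    have h0 : (0 : Matrix ι κ K).map (fun x => x ^ q ^ r) = 0 := by
      ext i j; simp [hq]
    rw [h0]
    simp only [Matrix.mul_zero, Matrix.zero_mul, add_zero, zero_add]
    exact ⟨_, rfl⟩

theorem charpoly_of_intertwine {K ι κ : Type*} [Field K] [Fintype ι] [Fintype κ]
    [DecidableEq ι] [DecidableEq κ] (e : κ ≃ ι)
    (A : Matrix ι ι K) (B : Matrix κ κ K) (U : Matrix ι κ K)
    (hU : IsUnit (U.submatrix e id).det) (h : A * U = U * B) :
    A.charpoly = B.charpoly := by
  have h1 : A.submatrix e e * U.submatrix e id = U.submatrix e id * B := by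
    rw [Matrix.submatrix_mul_equiv, h]
    ext i j
    simp [Matrix.mul_apply]
  obtain ⟨V, hV⟩ := (Matrix.isUnit_iff_isUnit_det _).2 hU
  rw [← hV] at h1
  have h2 : A.submatrix e e = V.val * B * V⁻¹.val := by
    rw [← h1, Matrix.mul_assoc, Units.mul_inv, Matrix.mul_one]
  have h3 : (A.submatrix e e).charpoly = A.charpoly := by
    have := Matrix.charpoly_reindex e.symm A
    simpa [Matrix.reindex_apply] using this
  rw [← h3, h2, Matrix.coe_units_inv, Matrix.charpoly_units_conj]

/-- Skew product `X^i * Q`. -/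
noncomputable def skW {K : Type*} [Field K] (τ : ℕ → K →+* K) (Q : Polynomial K) (i : ℕ) :
    Polynomial K := Polynomial.X ^ i * Q.map (τ i)

theorem skewMul_eq {K : Type*} [Field K] (q : ℕ) (τ : ℕ → K →+* K)
    (hτ : ∀ i x, τ i x = x ^ q ^ i) (P Q : Polynomial K) :
    skewMul q P Q = ∑ k ∈ Finset.range (P.natDegree + 1),
      Polynomial.C (P.coeff k) * skW τ Q k := by
  have h : ∀ i, ∑ j ∈ Q.support,
      Polynomial.C (P.coeff i * Q.coeff j ^ q ^ i) * Polynomial.X ^ (i + j)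
      = Polynomial.C (P.coeff i) * skW τ Q i := by
    intro i
    have : Q.map (τ i) = ∑ j ∈ Q.support,
        Polynomial.C (Q.coeff j ^ q ^ i) * Polynomial.X ^ j := by
      conv_lhs => rw [Q.as_sum_support_C_mul_X_pow]
      simp [Polynomial.map_sum, hτ]
    rw [skW, this, Finset.mul_sum, Finset.mul_sum]
    refine Finset.sum_congr rfl fun j _ => ?_
    rw [Polynomial.C_mul, pow_add]
    ring
  rw [skewMul, Finset.sum_congr rfl (fun i _ => h i)]
  refine Finset.sum_subset Polynomial.supp_subset_range_natDegree_succ ?_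
  intro k _ hk
  simp [Polynomial.notMem_support_iff.1 hk]

theorem skW_monic {K : Type*} [Field K] (τ : ℕ → K →+* K) (Q : Polynomial K) (hQ : Q.Monic)
    (i : ℕ) : (skW τ Q i).Monic := (Polynomial.monic_X_pow i).mul (hQ.map _)

theorem skW_natDegree {K : Type*} [Field K] (τ : ℕ → K →+* K) (Q : Polynomial K) (hQ : Q.Monic)
    (i : ℕ) : (skW τ Q i).natDegree = Q.natDegree + i := by
  rw [skW, (Polynomial.monic_X_pow i).natDegree_mul (hQ.map _), Polynomial.natDegree_X_pow,
    Polynomial.natDegree_map, add_comm]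

theorem skewMul_natDegree {K : Type*} [Field K] (q : ℕ) (τ : ℕ → K →+* K)
    (hτ : ∀ i x, τ i x = x ^ q ^ i) (P Q : Polynomial K) (hP : P.Monic) (hQ : Q.Monic) :
    (skewMul q P Q).natDegree = Q.natDegree + P.natDegree := by
  rw [skewMul_eq q τ hτ, Finset.sum_range_succ, hP.coeff_natDegree, Polynomial.C_1, one_mul,
    add_comm, ← skW_natDegree τ Q hQ P.natDegree]
  apply Polynomial.natDegree_add_eq_left_of_degree_lt
  rw [Polynomial.degree_eq_natDegree (skW_monic τ Q hQ _).ne_zero, skW_natDegree τ Q hQ]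
  rw [Polynomial.degree_lt_iff_coeff_zero]
  intro t ht
  rw [Polynomial.finsetSum_coeff]
  refine Finset.sum_eq_zero fun k hk => ?_
  rw [Polynomial.coeff_C_mul, Polynomial.coeff_eq_zero_of_natDegree_lt (p := skW τ Q k), mul_zero]
  rw [skW_natDegree τ Q hQ]
  have := Finset.mem_range.1 hk
  omega

/-- Base change matrix with columns `1, X, …, X^(n-1), Q, XQ, …, X^(m-1)Q`. -/
noncomputable def baseU {K : Type*} [Field K] (τ : ℕ → K →+* K) (Q : Polynomial K) (n m : ℕ) :
    Matrix (Fin (n + m)) (Fin n ⊕ Fin m) K :=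
  Matrix.of fun i s => (Sum.elim (fun j : Fin n => (Polynomial.X ^ (j : ℕ) : Polynomial K))
    (fun j : Fin m => skW τ Q j) s).coeff i

theorem baseU_det {K : Type*} [Field K] (τ : ℕ → K →+* K) (Q : Polynomial K) (hQ : Q.Monic)
    (n m : ℕ) (hn : Q.natDegree = n) :
    ((baseU τ Q n m).submatrix finSumFinEquiv id).det = 1 := by
  rw [← Matrix.fromBlocks_toBlocks ((baseU τ Q n m).submatrix finSumFinEquiv id)]
  have h21 : ((baseU τ Q n m).submatrix finSumFinEquiv id).toBlocks₂₁ = 0 := by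
    ext i j
    have := j.2
    simp [baseU, Matrix.toBlocks₂₁, Polynomial.coeff_X_pow]
    omega
  have h11 : ((baseU τ Q n m).submatrix finSumFinEquiv id).toBlocks₁₁ = 1 := by
    ext i j
    simp [baseU, Matrix.toBlocks₁₁, Polynomial.coeff_X_pow, Matrix.one_apply, Fin.ext_iff]
  rw [h21, h11, Matrix.det_fromBlocks_zero₂₁, Matrix.det_one, one_mul,
    Matrix.det_of_isUpperTriangular]
  · refine Finset.prod_eq_one fun j _ => ?_
    have := (skW_monic τ Q hQ j).coeff_natDegree
    rw [skW_natDegree τ Q hQ, hn] at this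
    simpa [baseU, Matrix.toBlocks₂₂] using this
  · intro i j hij
    simp only [id] at hij
    have : (skW τ Q j).coeff (n + i) = 0 := by
      apply Polynomial.coeff_eq_zero_of_natDegree_lt
      rw [skW_natDegree τ Q hQ, hn]
      have : (j : ℕ) < i := hij
      omega
    simpa [baseU, Matrix.toBlocks₂₂] using this

/-- The off-diagonal block. -/
def offC (K : Type*) [Field K] (n m : ℕ) : Matrix (Fin m) (Fin n) K :=
  Matrix.of fun i j => if (i : ℕ) = 0 ∧ (j : ℕ) = n - 1 then 1 else 0

theorem baseU_intertwine {K : Type*} [Field K] (q : ℕ) (hq : q ≠ 0) (τ : ℕ → K →+* K)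
    (hτ : ∀ i x, τ i x = x ^ q ^ i) (P Q : Polynomial K) (hP : P.Monic) (hQ : Q.Monic)
    (n m : ℕ) (hn : Q.natDegree = n) (hm : P.natDegree = m) (hm0 : 0 < m) :
    compG (n + m) (skewMul q P Q) * (baseU τ Q n m).map (fun x => x ^ q)
      = baseU τ Q n m * Matrix.fromBlocks (compG n Q) 0 (offC K n m) (compG m P) := by
  have hτ1 : ∀ x, x ^ q = τ 1 x := fun x => by rw [hτ, pow_one]
  ext i s
  rcases s with j | j
  · have hj := j.2
    have hL : (compG (n + m) (skewMul q P Q) * (baseU τ Q n m).map (fun x => x ^ q)) i (Sum.inl j)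
        = (Polynomial.X ^ ((j : ℕ) + 1) : Polynomial K).coeff i := by
      have := compG_row (n + m) (skewMul q P Q) (Polynomial.X ^ (j : ℕ)) i
      rw [← pow_succ', Polynomial.coeff_X_pow (j : ℕ) (n + m - 1), if_neg (by omega), mul_zero,
        sub_zero] at this
      rw [← this, Matrix.mul_apply]
      refine Finset.sum_congr rfl fun k _ => ?_
      congr 1
      simp only [baseU, Matrix.map_apply, Matrix.of_apply, Sum.elim_inl, Polynomial.coeff_X_pow]
      split_ifs <;> simp [hq]
    rw [hL, Matrix.mul_apply, Fintype.sum_sum_type]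
    have h1 := congrArg (fun f => f.coeff (i : ℕ))
      (compG_col Q hQ n hn (fun k => Polynomial.X ^ k) j)
    have hQs : ∑ k ∈ Finset.range (n + 1), Polynomial.C (Q.coeff k) * Polynomial.X ^ k = Q := by
      rw [← hn]; exact Q.as_sum_range_C_mul_X_pow.symm
    simp only [Polynomial.finsetSum_coeff, Polynomial.coeff_C_mul, Polynomial.coeff_sub, hQs] at h1
    have h2 : ∑ k : Fin n, baseU τ Q n m i (Sum.inl k) *
        Matrix.fromBlocks (compG n Q) 0 (offC K n m) (compG m P) (Sum.inl k) (Sum.inl j)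
        = ∑ k : Fin n, compG n Q k j * (Polynomial.X ^ (k : ℕ) : Polynomial K).coeff i :=
      Finset.sum_congr rfl fun k _ => by simp [baseU, mul_comm]
    have hW0 : skW τ Q 0 = Q := by
      have : τ 0 = RingHom.id K := by ext x; simp [hτ]
      simp [skW, this]
    have h3 : ∑ k : Fin m, baseU τ Q n m i (Sum.inr k) *
        Matrix.fromBlocks (compG n Q) 0 (offC K n m) (compG m P) (Sum.inr k) (Sum.inl j)
        = (if (j : ℕ) = n - 1 then Q else 0).coeff i := by
      rw [Finset.sum_eq_single ⟨0, hm0⟩]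
      · simp only [baseU, Matrix.of_apply, Sum.elim_inr, hW0, Matrix.fromBlocks_apply₂₁, offC]
        split_ifs <;> simp_all
      · intro b _ hb
        have : (b : ℕ) ≠ 0 := fun h => hb (Fin.ext h)
        simp [offC, this]
      · simp
    rw [h2, h3, h1]
    ring
  · have hj := j.2
    have hWs : ∀ k, (skW τ Q k).map (τ 1) * Polynomial.X = skW τ Q (k + 1) := by
      intro k
      have : (τ 1).comp (τ k) = τ (k + 1) := by
        ext x; simp [hτ, ← pow_mul, pow_succ]
      simp only [skW, Polynomial.map_mul, Polynomial.map_pow, Polynomial.map_X,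
        Polynomial.map_map, this]
      ring
    have htop : ((skW τ Q j).map (τ 1)).coeff (n + m - 1) = if (j : ℕ) = m - 1 then 1 else 0 := by
      rw [Polynomial.coeff_map]
      split_ifs with h
      · have := (skW_monic τ Q hQ j).coeff_natDegree
        rw [skW_natDegree τ Q hQ, hn] at this
        rw [show n + m - 1 = n + j by omega, this, map_one]
      · rw [Polynomial.coeff_eq_zero_of_natDegree_lt, map_zero]
        rw [skW_natDegree τ Q hQ]; omega
    have hL : (compG (n + m) (skewMul q P Q) * (baseU τ Q n m).map (fun x => x ^ q)) i (Sum.inr j)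
        = (skW τ Q (j + 1)).coeff i - (skewMul q P Q).coeff i * if (j : ℕ) = m - 1 then 1 else 0 := by
      have := compG_row (n + m) (skewMul q P Q) ((skW τ Q j).map (τ 1)) i
      rw [htop, mul_comm Polynomial.X, hWs] at this
      rw [← this, Matrix.mul_apply]
      refine Finset.sum_congr rfl fun k _ => ?_
      congr 1
      simp [baseU, hτ]
    have h1 := congrArg (fun f => f.coeff (i : ℕ)) (compG_col P hP m hm (skW τ Q) j)
    have hR := skewMul_eq q τ hτ P Q
    rw [hm] at hR
    rw [← hR] at h1
    simp only [Polynomial.finsetSum_coeff, Polynomial.coeff_C_mul, Polynomial.coeff_sub] at h1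
    rw [hL, Matrix.mul_apply, Fintype.sum_sum_type]
    have h3 : ∑ k : Fin m, baseU τ Q n m i (Sum.inr k) *
        Matrix.fromBlocks (compG n Q) 0 (offC K n m) (compG m P) (Sum.inr k) (Sum.inr j)
        = ∑ k : Fin m, compG m P k j * (skW τ Q k).coeff i :=
      Finset.sum_congr rfl fun k _ => by simp [baseU, mul_comm]
    rw [h3, h1]
    split_ifs <;> simp

/-- For monic nonconstant skew polynomials `P, Q ∈ F_{q^r}[X,σ]`,
the map `Ψ` is multiplicative: `Ψ(PQ) = Ψ(P)·Ψ(Q)`. -/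
theorem Psi_multiplicative
    (p a q r : ℕ) (hp : p.Prime) (ha : 0 < a) (hq : q = p ^ a) (hr : 0 < r)
    (F : Type*) [Field F] [Fintype F] [CharP F p] (hF : Fintype.card F = q ^ r)
    (P Q : Polynomial F) (hP : P.Monic) (hQ : Q.Monic)
    (hP1 : 0 < P.natDegree) (hQ1 : 0 < Q.natDegree) :
    Psi q r (skewMul q P Q) = Psi q r P * Psi q r Q := by
  have : Fact p.Prime := ⟨hp⟩
  have hq0 : q ≠ 0 := by rw [hq]; exact pow_ne_zero _ hp.ne_zero
  let τ : ℕ → F →+* F := fun i => iterateFrobenius F p (a * i)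
  have hτ : ∀ i x, τ i x = x ^ q ^ i := by
    intro i x
    simp only [τ, iterateFrobenius_def, hq, pow_mul]
  have hU := baseU_intertwine q hq0 τ hτ P Q hP hQ _ _ rfl rfl hP1
  have hI := prod_intertwine q τ hτ _ _ _ hU r
  have hid : (baseU τ Q Q.natDegree P.natDegree).map (fun x => x ^ q ^ r)
      = baseU τ Q Q.natDegree P.natDegree := by
    ext i j
    simp only [Matrix.map_apply, ← hF, FiniteField.pow_card]
  rw [hid] at hI
  obtain ⟨D, hD⟩ := prod_blocks q hq0 (compG Q.natDegree Q) (compG P.natDegree P)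
    (offC F Q.natDegree P.natDegree) r
  rw [Psi_eq_compG q r _ _ (skewMul_natDegree q τ hτ P Q hP hQ),
    charpoly_of_intertwine finSumFinEquiv _ _ _
      (by rw [baseU_det τ Q hQ _ _ rfl]; exact isUnit_one) hI, hD,
    Matrix.charpoly_fromBlocks_zero₁₂, Psi_eq_compG q r _ P rfl, Psi_eq_compG q r _ Q rfl,
    mul_comm]
end

section
/- Let D be a simple étale φ-module over F_{q^r} of dimension d. Then the ring End(D) of φ-equivariant F_{q^r}-linear endomorphisms of D equals F_q[φ^r] and is isomorphic to the field F_{q^d}. -/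
open Polynomial

theorem aux_card_fixed (F : Type*) [Field F] [Fintype F] (q r : ℕ) (hq1 : 1 < q) (hr : 0 < r)
    (hF : Fintype.card F = q ^ r) : Nat.card {c : F // c ^ q = c} = q := by
  classical
  have hdvd : ∀ n : ℕ, (X ^ q - X : F[X]) ∣ X ^ (q ^ n) - X := by
    intro n
    induction n with
    | zero => simp
    | succ n ih =>
      have h := sub_dvd_pow_sub_pow (X ^ q : F[X]) X (q ^ n)
      have h2 := dvd_add h ih
      rw [← pow_mul] at h2
      rw [pow_succ']
      simpa using h2
  have h0 : (X ^ (q ^ r) - X : F[X]) ≠ 0 :=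
    FiniteField.X_pow_card_pow_sub_X_ne_zero F hr.ne' hq1
  have h1 : (X ^ q - X : F[X]) ≠ 0 := FiniteField.X_pow_card_sub_X_ne_zero F hq1
  have hroots : (X ^ (q ^ r) - X : F[X]).roots = Finset.univ.val := by
    rw [← hF]; exact FiniteField.roots_X_pow_card_sub_X F
  have hs : (X ^ (q ^ r) - X : F[X]).Splits := by
    rw [splits_iff_card_roots, hroots, FiniteField.X_pow_card_pow_sub_X_natDegree_eq F hr.ne' hq1,
      ← hF]; rfl
  have hs2 : (X ^ q - X : F[X]).Splits := hs.of_dvd h0 (hdvd r)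
  rw [splits_iff_card_roots, FiniteField.X_pow_card_sub_X_natDegree_eq F hq1] at hs2
  have hnd : (X ^ q - X : F[X]).roots.Nodup :=
    Multiset.nodup_of_le (Polynomial.roots.le_of_dvd h0 (hdvd r)) (by rw [hroots]; exact Finset.univ.nodup)
  rw [← Multiset.toFinset_card_of_nodup hnd] at hs2
  rw [Nat.card_eq_fintype_card]
  refine Eq.trans ?_ hs2
  rw [← Fintype.card_coe]
  refine Fintype.card_congr (Equiv.subtypeEquivRight fun c => ?_)
  rw [Multiset.mem_toFinset, mem_roots h1]
  simp [sub_eq_zero]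

theorem aux_indep (F : Type*) [Field F] [Fintype F] (q r : ℕ) (hq1 : 1 < q)
    (hF : Fintype.card F = q ^ r) (D : Type*) [AddCommGroup D] [Module F D]
    (x : ℕ → D) (hx : ∀ c : F, ∑ i ∈ Finset.range r, c ^ (q ^ i) • x i = 0) :
    ∀ i < r, x i = 0 := by
  intro i hi
  rw [← Module.forall_dual_apply_eq_zero_iff F]
  intro f
  set P : F[X] := ∑ i ∈ Finset.range r, C (f (x i)) * X ^ (q ^ i) with hP
  have hP0 : P = 0 := by
    refine Polynomial.eq_zero_of_natDegree_lt_card_of_eval_eq_zero P (ι := F) (f := id)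
      Function.injective_id ?_ ?_
    · intro c
      have := congrArg f (hx c)
      simp only [map_sum, map_smul, map_zero, smul_eq_mul] at this
      rw [hP, eval_finsetSum, ← this]
      refine Finset.sum_congr rfl fun j _ => ?_
      rw [eval_mul, eval_C, eval_pow, eval_X, mul_comm, id]
    · rw [hF]
      refine lt_of_le_of_lt (natDegree_sum_le_of_forall_le (n := q ^ r - 1) _ _ ?_) ?_
      · intro j hj
        refine (natDegree_C_mul_X_pow_le _ _).trans ?_
        exact Nat.le_sub_one_of_lt (Nat.pow_lt_pow_right hq1 (Finset.mem_range.1 hj))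
      · have : 0 < q ^ r := by positivity
        omega
  have hc : P.coeff (q ^ i) = f (x i) := by
    rw [hP, finsetSum_coeff, Finset.sum_eq_single i]
    · simp
    · intro j _ hj
      rw [coeff_C_mul_X_pow, if_neg]
      intro h
      exact hj (Nat.pow_right_injective hq1 h).symm
    · intro h; exact absurd (Finset.mem_range.2 hi) h
  rw [← hc, hP0, coeff_zero]

theorem aux_card_degreeLT (F : Type*) [Field F] [Fintype F] (m : ℕ) :
    Nat.card (degreeLT F m) = Fintype.card F ^ m := by
  rw [Nat.card_congr (degreeLTEquiv F m).toEquiv]; simp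

theorem aux_card_degreeLT_fixed (F : Type*) [Field F] [Fintype F] (q m : ℕ) (hq1 : 1 < q) :
    Nat.card {g : F[X] // g ∈ degreeLT F m ∧ ∀ n, g.coeff n ^ q = g.coeff n} =
      Nat.card {c : F // c ^ q = c} ^ m := by
  have : Nat.card (Fin m → {c : F // c ^ q = c}) = Nat.card {c : F // c ^ q = c} ^ m := by
    rw [Nat.card_fun, Nat.card_fin]
  rw [← this]
  refine Nat.card_congr (Equiv.ofBijective (fun g i => ⟨g.1.coeff i, g.2.2 i⟩) ⟨?_, ?_⟩)
  · intro g h hgh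
    apply Subtype.ext
    ext n
    by_cases hn : n < m
    · have := congrFun hgh ⟨n, hn⟩
      simpa using congrArg Subtype.val this
    · rw [coeff_eq_zero_of_degree_lt, coeff_eq_zero_of_degree_lt]
      · exact (mem_degreeLT.1 h.2.1).trans_le (by exact_mod_cast not_lt.1 hn)
      · exact (mem_degreeLT.1 g.2.1).trans_le (by exact_mod_cast not_lt.1 hn)
  · intro f
    have hc : ∀ n, (∑ i : Fin m, monomial i (f i : F)).coeff n = if h : n < m then (f ⟨n, h⟩ : F) else 0 := by
      intro n
      rw [finsetSum_coeff]
      simp only [coeff_monomial]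
      split_ifs with h
      · rw [Finset.sum_eq_single ⟨n, h⟩]
        · simp
        · intro b _ hb
          rw [if_neg]
          intro h'; exact hb (Fin.ext h')
        · simp
      · refine Finset.sum_eq_zero fun i _ => if_neg ?_
        have := i.2; omega
    refine ⟨⟨∑ i : Fin m, monomial i (f i : F), ?_, ?_⟩, ?_⟩
    · rw [mem_degreeLT, degree_lt_iff_coeff_zero]
      intro n hn
      rw [hc, dif_neg (by omega)]
    · intro n
      rw [hc]
      split_ifs with h
      · exact (f ⟨n, h⟩).2
      · exact zero_pow (by omega)
    · funext i
      apply Subtype.ext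
      simp [hc]

theorem aux_density (D : Type*) [AddCommGroup D] [Finite D]
    (R : Subring (AddMonoid.End D)) [IsSimpleModule R D] :
    (∃ n : ℕ, Nat.card (Module.End R D) ^ n = Nat.card D ∧ Nat.card D ^ n ≤ Nat.card R) ∧
    (∀ u : Module.End R D, ∃ x : R, ∀ v : D, u v = x • v) ∧
    (∀ u : Module.End R D, u ≠ 0 → ∃ w : Module.End R D, u * w = 1) := by
  classical
  have : Fintype D := Fintype.ofFinite D
  have finE : Finite (Module.End R D) := Finite.of_injective (fun u => (u : D → D)) DFunLike.coe_injective
  have finR : Finite (AddMonoid.End D) := Finite.of_injective (fun u => (u : D → D)) DFunLike.coe_injective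
  have hdens : ∀ f : Module.End (Module.End R D) D, ∃ x : R, ∀ v : D, f v = x • v := by
    intro f
    obtain ⟨x, hx⟩ := jacobson_density (R := R) f Finset.univ
    exact ⟨x, fun v => hx v (Finset.mem_univ v)⟩
  have hcomm : ∀ u w : Module.End R D, u * w = w * u :=
    (Finite.isDomain_to_isField (Module.End R D)).mul_comm
  refine ⟨?_, ?_, ?_⟩
  · have : Fintype (Module.End R D) := Fintype.ofFinite _
    have : Module.Finite (Module.End R D) D := Module.Finite.of_finite
    let b := Module.finBasis (Module.End R D) D
    refine ⟨Module.finrank (Module.End R D) D, ?_, ?_⟩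
    · rw [Nat.card_eq_fintype_card, Nat.card_eq_fintype_card,
        Module.card_eq_pow_finrank (K := Module.End R D) (V := D)]
    · have h1 : Nat.card (Module.End (Module.End R D) D) =
          Nat.card D ^ Module.finrank (Module.End R D) D := by
        rw [← Nat.card_congr (b.constr ℕ (M' := D)).toEquiv, Nat.card_fun, Nat.card_fin]
      rw [← h1]
      choose x hx using hdens
      refine Nat.card_le_card_of_injective x ?_
      intro f g hfg
      ext v
      rw [hx, hx, hfg]
  · intro u
    exact hdens
      { toFun := u
        map_add' := map_add u
        map_smul' := fun w v => congrArg (fun t : Module.End R D => t v) (hcomm u w) }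
  · intro u hu
    exact ⟨u⁻¹, mul_inv_cancel₀ hu⟩


/-- Let `D` be a simple étale `φ`-module over `F_{q^r}` of dimension `d`,
and let `ψ = φ^r` (an `F_{q^r}`-linear map). Then the ring `End(D)` of `φ`-equivariant
`F_{q^r}`-linear endomorphisms of `D` equals `F_q[φ^r]` (polynomials in `ψ` with
coefficients in the fixed field `F_q = {c | c^q = c}`), and is isomorphic to the field
`F_{q^d}`: it has `q^d` elements and every nonzero element is invertible in it. -/
theorem end_of_simple_phi_module
    (p a q r : ℕ) (hp : p.Prime) (ha : 0 < a) (hq : q = p ^ a) (hr : 0 < r)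
    (F : Type*) [Field F] [Fintype F] [CharP F p] (hF : Fintype.card F = q ^ r)
    (D : Type*) [AddCommGroup D] [Module F D] [FiniteDimensional F D] [Nontrivial D]
    (d : ℕ) (hd : Module.finrank F D = d)
    (φ : D → D) (hadd : ∀ u v : D, φ (u + v) = φ u + φ v)
    (hsemi : ∀ (s : F) (u : D), φ (s • u) = s ^ q • φ u)
    (hetale : Submodule.span F (Set.range φ) = ⊤)
    (hsimple : ∀ W : Submodule F D, (∀ y ∈ W, φ y ∈ W) → W = ⊥ ∨ W = ⊤)
    (ψ : Module.End F D) (hψ : ∀ u : D, ψ u = φ^[r] u) :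
    {u : Module.End F D | ∀ v : D, u (φ v) = φ (u v)} =
      {u : Module.End F D | ∃ g : Polynomial F,
        (∀ n : ℕ, g.coeff n ^ q = g.coeff n) ∧ u = Polynomial.aeval ψ g} ∧
    Nat.card {u : Module.End F D // ∀ v : D, u (φ v) = φ (u v)} = q ^ d ∧
    (∀ u : Module.End F D, (∀ v : D, u (φ v) = φ (u v)) → u ≠ 0 →
      ∃ w : Module.End F D, (∀ v : D, w (φ v) = φ (w v)) ∧ u * w = 1) := by
  classical
  have hq1 : 1 < q := by rw [hq]; exact Nat.one_lt_pow ha.ne' hp.one_lt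
  have : Fact p.Prime := ⟨hp⟩
  have finD : Finite D := Module.finite_of_finite F
  have hcardD : Nat.card D = q ^ (r * d) := by
    rw [Module.natCard_eq_pow_finrank (K := F), hd, Nat.card_eq_fintype_card, hF, pow_mul]
  -- Frobenius as a ring homomorphism
  obtain ⟨σ, hσ⟩ : ∃ σ : F →+* F, ∀ x, σ x = x ^ q :=
    ⟨iterateFrobenius F p a, fun x => by rw [iterateFrobenius_def, hq]⟩
  have hφ0 : φ 0 = 0 := by
    have := hadd 0 0
    simpa using this
  -- φ is injective, hence surjective
  have hφinj : ∀ v, φ v = 0 → v = 0 := by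
    let W : Submodule F D :=
      { carrier := {v | φ v = 0}
        add_mem' := by
          intro x y hx hy
          simp only [Set.mem_ofPred_eq] at *
          rw [hadd, hx, hy, add_zero]
        zero_mem' := hφ0
        smul_mem' := by
          intro c x hx
          simp only [Set.mem_ofPred_eq] at *
          rw [hsemi, hx, smul_zero] }
    have hW : ∀ v, v ∈ W ↔ φ v = 0 := fun v => Iff.rfl
    rcases hsimple W (fun y hy => by rw [hW] at *; rw [hy, hφ0]) with h | h
    · intro v hv
      rw [← hW, h] at hv
      simpa using hv
    · exfalso
      have : Submodule.span F (Set.range φ) = ⊥ := by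
        rw [Submodule.span_eq_bot]
        rintro _ ⟨v, rfl⟩
        rw [← hW, h]; trivial
      rw [hetale] at this
      exact top_ne_bot this
  have haddE : ∀ (x y : AddMonoid.End D) (v : D), (x + y) v = x v + y v := fun _ _ _ => rfl
  have hmulE : ∀ (x y : AddMonoid.End D) (v : D), (x * y) v = x (y v) := fun _ _ _ => rfl
  let Φ : AddMonoid.End D := AddMonoidHom.mk' φ hadd
  have hΦ : ∀ v, Φ v = φ v := fun v => rfl
  have hΦsum : ∀ (s : Finset ℕ) (f : ℕ → D), φ (∑ i ∈ s, f i) = ∑ i ∈ s, φ (f i) :=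
    fun s f => map_sum Φ f s
  have hφsurj : Function.Surjective φ := by
    refine Finite.surjective_of_injective ?_
    exact (injective_iff_map_eq_zero Φ).2 hφinj
  have hit : ∀ (i : ℕ) (c : F) (v : D), φ^[i] (c • v) = c ^ (q ^ i) • φ^[i] v := by
    intro i
    induction i with
    | zero => intro c v; simp
    | succ i ih =>
      intro c v
      rw [Function.iterate_succ_apply', ih, hsemi, Function.iterate_succ_apply', ← pow_mul,
        ← pow_succ]
  have hψφ : ∀ v, ψ (φ v) = φ (ψ v) := by
    intro v
    rw [hψ, hψ, ← Function.iterate_succ_apply, Function.iterate_succ_apply']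
  have hψi : ∀ (i : ℕ) (v : D), φ ((ψ ^ i) v) = (ψ ^ i) (φ v) := by
    intro i
    induction i with
    | zero => intro v; simp
    | succ i ih =>
      intro v
      rw [pow_succ, Module.End.mul_apply, Module.End.mul_apply, ih, hψφ]
  have hconj : ∀ (g : F[X]) (v : D), φ (aeval ψ g v) = aeval ψ (g.map σ) (φ v) := by
    intro g v
    induction g using Polynomial.induction_on' with
    | add g h hg hh => simp only [map_add, Polynomial.map_add, LinearMap.add_apply, hadd, hg, hh]
    | monomial n c =>
      simp only [map_monomial, aeval_monomial, Module.End.mul_apply, Module.algebraMap_end_apply,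
        hsemi, hψi, hσ]
  set P := minpoly F ψ with hP
  have hintegral : IsIntegral F ψ := Algebra.IsIntegral.isIntegral ψ
  have hmonic : P.Monic := minpoly.monic hintegral
  set m := P.natDegree with hm
  have hdegP : P.degree = m := degree_eq_natDegree hmonic.ne_zero
  have hmd : m ≤ d := by
    rw [← hd, ← LinearMap.charpoly_natDegree ψ]
    exact natDegree_le_of_dvd (LinearMap.minpoly_dvd_charpoly ψ) (LinearMap.charpoly_monic ψ).ne_zero
  have hmod : ∀ g : F[X], aeval ψ (g %ₘ P) = aeval ψ g := by
    intro g
    conv_rhs => rw [← modByMonic_add_div g P]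
    rw [map_add, map_mul, hP, minpoly.aeval, zero_mul, add_zero]
  have hmodmem : ∀ g : F[X], g %ₘ P ∈ degreeLT F m := by
    intro g
    rw [mem_degreeLT, ← hdegP]
    exact degree_modByMonic_lt g hmonic
  have hinj : ∀ g ∈ degreeLT F m, ∀ h ∈ degreeLT F m, aeval ψ g = aeval ψ h → g = h := by
    intro g hg h hh hgh
    have hs : g - h ∈ degreeLT F m := Submodule.sub_mem _ hg hh
    rw [mem_degreeLT, ← hdegP] at hs
    by_contra hne
    have := minpoly.degree_le_of_ne_zero F ψ (sub_ne_zero.2 hne) (by rw [map_sub, hgh, sub_self])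
    exact absurd hs (not_lt.2 this)
  -- polynomials with fixed coefficients commute with φ
  have hfix : ∀ g : F[X], (∀ n, g.coeff n ^ q = g.coeff n) →
      ∀ v, (aeval ψ g) (φ v) = φ (aeval ψ g v) := by
    intro g hg v
    rw [hconj]
    congr 2
    ext n
    rw [coeff_map, hσ, hg]
  -- elements of F[ψ] commuting with φ
  have hfix' : ∀ g ∈ degreeLT F m, (∀ v, (aeval ψ g) (φ v) = φ (aeval ψ g v)) →
      (∀ n, g.coeff n ^ q = g.coeff n) := by
    intro g hg hc n
    have h1 : g.map σ = g := by
      refine hinj _ ?_ _ hg ?_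
      · rw [mem_degreeLT] at *
        exact lt_of_le_of_lt degree_map_le hg
      · ext v
        obtain ⟨w, rfl⟩ := hφsurj v
        rw [← hconj, hc]
    conv_rhs => rw [← h1, coeff_map, hσ]
  -- the ring generated by F and φ
  let S : Set (AddMonoid.End D) := insert Φ (Set.range (DistribSMul.toAddMonoidHom D : F → (D →+ D)))
  let R : Subring (AddMonoid.End D) := Subring.closure S
  have hΦR : Φ ∈ R := Subring.subset_closure (Set.mem_insert _ _)
  have hFR : ∀ c : F, (DistribSMul.toAddMonoidHom D c : AddMonoid.End D) ∈ R := fun c =>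
    Subring.subset_closure (Set.mem_insert_of_mem _ ⟨c, rfl⟩)
  have hRform : ∀ x ∈ R, ∃ g : ℕ → F[X], ∀ v, x v = ∑ i ∈ Finset.range r, aeval ψ (g i) (φ^[i] v) := by
    let T : AddSubgroup (AddMonoid.End D) :=
      { carrier := {x | ∃ g : ℕ → F[X], ∀ v, x v = ∑ i ∈ Finset.range r, aeval ψ (g i) (φ^[i] v)}
        add_mem' := by
          rintro x y ⟨g, hg⟩ ⟨h, hh⟩
          refine ⟨g + h, fun v => ?_⟩
          rw [haddE, hg, hh, ← Finset.sum_add_distrib]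
          simp
        zero_mem' := ⟨0, fun v => by simp⟩
        neg_mem' := by
          rintro x ⟨g, hg⟩
          refine ⟨-g, fun v => ?_⟩
          have : (-x) v = - (x v) := rfl
          rw [this, hg]
          simp }
    have hT1 : (1 : AddMonoid.End D) ∈ T := by
      refine ⟨fun i => if i = 0 then 1 else 0, fun v => ?_⟩
      rw [Finset.sum_eq_single 0]
      · simp
      · intro i _ hi; simp [hi]
      · intro h; exact absurd (Finset.mem_range.2 hr) h
    have hTS : ∀ s ∈ S, ∀ t ∈ T, s * t ∈ T := by
      rintro s hs t ⟨g, hg⟩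
      rcases hs with rfl | ⟨c, rfl⟩
      · obtain ⟨k, rfl⟩ : ∃ k, r = k + 1 := ⟨r - 1, by omega⟩
        refine ⟨fun i => if i = 0 then (g k).map σ * X else (g (i - 1)).map σ, fun v => ?_⟩
        rw [hmulE, hΦ, hg, hΦsum, Finset.sum_range_succ, Finset.sum_range_succ']
        congr 1
        · refine Finset.sum_congr rfl fun i _ => ?_
          beta_reduce
          rw [hconj, if_neg (Nat.succ_ne_zero i), Function.iterate_succ_apply', Nat.add_sub_cancel]
        · beta_reduce
          rw [hconj, if_pos rfl, map_mul, aeval_X, Module.End.mul_apply, hψ,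
            Function.iterate_zero, id, Function.iterate_succ_apply' φ k v]
      · refine ⟨fun i => C c * g i, fun v => ?_⟩
        change c • (t v) = _
        rw [hg, Finset.smul_sum]
        refine Finset.sum_congr rfl fun i _ => ?_
        rw [map_mul, aeval_C, Module.End.mul_apply, Module.algebraMap_end_apply]
    have hTR : ∀ x ∈ R, ∀ t ∈ T, x * t ∈ T := by
      intro x hx
      induction hx using Subring.closure_induction with
      | mem x hx => exact hTS x hx
      | zero => intro t _; rw [zero_mul]; exact T.zero_mem
      | one => intro t ht; rwa [one_mul]
      | add x y _ _ hx hy => intro t ht; rw [add_mul]; exact T.add_mem (hx t ht) (hy t ht)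
      | neg x _ hx => intro t ht; rw [neg_mul]; exact T.neg_mem (hx t ht)
      | mul x y _ _ hx hy => intro t ht; rw [mul_assoc]; exact hx _ (hy t ht)
    intro x hx
    have := hTR x hx 1 hT1
    rwa [mul_one] at this
  have hcardR : Nat.card R ≤ q ^ (r * m * r) := by
    have h1 : Nat.card (Fin r → degreeLT F m) = q ^ (r * m * r) := by
      rw [Nat.card_fun, aux_card_degreeLT, Nat.card_fin, hF, pow_mul, pow_mul]
    rw [← h1]
    choose g hg using fun x : R => hRform x.1 x.2
    have : Finite (degreeLT F m) := Finite.of_equiv _ (degreeLTEquiv F m).toEquiv.symm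
    refine Nat.card_le_card_of_injective (fun x i => ⟨g x i %ₘ P, hmodmem _⟩) ?_
    intro x y hxy
    apply Subtype.ext
    ext v
    rw [hg, hg]
    refine Finset.sum_congr rfl fun i hi => ?_
    have := congrArg Subtype.val (congrFun hxy ⟨i, Finset.mem_range.1 hi⟩)
    simp only at this
    rw [← hmod, this, hmod]
  have hRsimple : IsSimpleModule R D := by
    refine { eq_bot_or_eq_top := fun W => ?_ }
    let W' : Submodule F D :=
      { carrier := W
        add_mem' := fun hx hy => W.add_mem hx hy
        zero_mem' := W.zero_mem
        smul_mem' := fun c x hx => W.smul_mem (⟨_, hFR c⟩ : R) hx }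
    have hW : ∀ v, v ∈ W' ↔ v ∈ W := fun v => Iff.rfl
    rcases hsimple W' (fun y hy => W.smul_mem (⟨_, hΦR⟩ : R) hy) with h | h
    · left
      ext v
      rw [← hW, h]; simp
    · right
      ext v
      rw [← hW, h]; simp
  obtain ⟨⟨n, hn1, hn2⟩, hER, hinv⟩ := aux_density D R
  -- comparison of the two endomorphism rings
  have toE : ∀ u : Module.End F D, (∀ v, u (φ v) = φ (u v)) → ∃ u' : Module.End R D, ∀ v, u' v = u v := by
    intro u hu
    have key : ∀ x ∈ R, ∀ v, u (x v) = x (u v) := by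
      intro x hx
      induction hx using Subring.closure_induction with
      | mem x hx =>
        rcases hx with rfl | ⟨c, rfl⟩
        · exact hu
        · exact fun v => map_smul u c v
      | zero => intro v; simp
      | one => intro v; simp
      | add x y _ _ hx hy =>
        intro v; rw [haddE, haddE, map_add, hx, hy]
      | neg x _ hx =>
        intro v
        change u (-(x v)) = -(x (u v))
        rw [map_neg, hx]
      | mul x y _ _ hx hy =>
        intro v; rw [hmulE, hmulE, hx, hy]
    exact ⟨{ toFun := u, map_add' := map_add u, map_smul' := fun x v => key x.1 x.2 v }, fun v => rfl⟩
  have fromE : ∀ u' : Module.End R D, ∃ u : Module.End F D,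
      (∀ v, u (φ v) = φ (u v)) ∧ ∀ v, u v = u' v := by
    intro u'
    exact ⟨{ toFun := u', map_add' := map_add u',
             map_smul' := fun c v => map_smul u' (⟨_, hFR c⟩ : R) v },
      fun v => map_smul u' (⟨_, hΦR⟩ : R) v, fun v => rfl⟩
  have hcardE : Nat.card {u : Module.End F D // ∀ v : D, u (φ v) = φ (u v)} =
      Nat.card (Module.End R D) := by
    choose f hf using toE
    refine Nat.card_congr (Equiv.ofBijective (fun u => f u.1 u.2) ⟨?_, ?_⟩)
    · intro u w huw
      apply Subtype.ext
      ext v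
      rw [← hf u.1 u.2, ← hf w.1 w.2]
      exact congrArg (fun t : Module.End R D => t v) huw
    · intro u'
      obtain ⟨u, hu, hu'⟩ := fromE u'
      refine ⟨⟨u, hu⟩, ?_⟩
      ext v
      rw [← hu']
      exact hf u hu v
  have hpoly : ∀ u : Module.End F D, (∀ v, u (φ v) = φ (u v)) →
      ∃ g ∈ degreeLT F m, (∀ n, g.coeff n ^ q = g.coeff n) ∧ u = aeval ψ g := by
    intro u hu
    obtain ⟨u', hu'⟩ := toE u hu
    obtain ⟨x, hx⟩ := hER u'
    obtain ⟨g, hg⟩ := hRform x.1 x.2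
    have hug : ∀ v, u v = ∑ i ∈ Finset.range r, aeval ψ (g i) (φ^[i] v) := by
      intro v
      rw [← hu', hx, ← hg]; rfl
    have h0 : u = aeval ψ (g 0 %ₘ P) := by
      rw [hmod]
      ext v
      have := aux_indep F q r hq1 hF D
        (fun i => aeval ψ (g i) (φ^[i] v) - if i = 0 then u v else 0) ?_ 0 hr
      · simp only [Function.iterate_zero, id, if_true] at this
        exact (sub_eq_zero.1 this).symm
      · intro c
        simp only [smul_sub, Finset.sum_sub_distrib]
        rw [sub_eq_zero]
        have h1 : ∑ i ∈ Finset.range r, c ^ q ^ i • aeval ψ (g i) (φ^[i] v) = u (c • v) := by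
          rw [hug]
          refine Finset.sum_congr rfl fun i _ => ?_
          rw [hit, map_smul]
        rw [h1, Finset.sum_eq_single 0]
        · simp
        · intro i _ hi; simp [hi]
        · intro h; exact absurd (Finset.mem_range.2 hr) h
    exact ⟨_, hmodmem _, hfix' _ (hmodmem _) (by rw [← h0]; exact hu), h0⟩
  have hcardE' : Nat.card {u : Module.End F D // ∀ v : D, u (φ v) = φ (u v)} = q ^ m := by
    have h1 := aux_card_degreeLT_fixed F q m hq1
    rw [aux_card_fixed F q r hq1 hr hF] at h1
    rw [← h1]
    symm
    refine Nat.card_congr (Equiv.ofBijective (fun g => ⟨aeval ψ g.1, hfix g.1 g.2.2⟩) ⟨?_, ?_⟩)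
    · intro g h hgh
      exact Subtype.ext (hinj _ g.2.1 _ h.2.1 (congrArg Subtype.val hgh))
    · rintro ⟨u, hu⟩
      obtain ⟨g, hg1, hg2, rfl⟩ := hpoly u hu
      exact ⟨⟨g, hg1, hg2⟩, rfl⟩
  have hdm : d = m := by
    rw [← hcardE, hcardE', hcardD, ← pow_mul] at hn1
    have e1 : m * n = r * d := Nat.pow_right_injective hq1 hn1
    have e2 : r * d * n ≤ r * m * r := by
      have := hn2.trans hcardR
      rw [hcardD, ← pow_mul] at this
      exact (Nat.pow_le_pow_iff_right hq1).1 this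
    have e3 : r * d * (m * n) ≤ r * m * r * m := by nlinarith
    rw [e1] at e3
    have e4 : (r * r) * (d * d) ≤ (r * r) * (m * m) := by nlinarith
    have e5 : d * d ≤ m * m := Nat.le_of_mul_le_mul_left e4 (by positivity)
    exact le_antisymm (Nat.mul_self_le_mul_self_iff.1 e5) hmd
  refine ⟨?_, ?_, ?_⟩
  · ext u
    constructor
    · intro hu
      obtain ⟨g, _, hg2, hg3⟩ := hpoly u hu
      exact ⟨g, hg2, hg3⟩
    · rintro ⟨g, hg, rfl⟩
      exact hfix g hg
  · rw [hcardE', hdm]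
  · intro u hu hu0
    obtain ⟨u', hu'⟩ := toE u hu
    obtain ⟨w', hw'⟩ := hinv u' (by
      rintro rfl
      apply hu0
      ext v
      rw [← hu']; simp)
    obtain ⟨w, hw, hww⟩ := fromE w'
    refine ⟨w, hw, ?_⟩
    ext v
    rw [Module.End.mul_apply, hww, ← hu']
    exact congrArg (fun t : Module.End R D => t v) hw'
end
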